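/- arXiv:2010.08443 — 3 statements merged into one kernel-verified Lean document; each statement's English description precedes it below -/
import Mathlib

section
/- Let p ≥ 1, σ > 0, M ≥ 0, h ∈ ℝᵖ, and let Q : ℝᵖ → ℝ be measurable with |Q(a)| ≤ M for all a. Then ‖∫_{ℝᵖ} Q(a) · σ^{−2}(a − h) · (2πσ²)^{−p/2} exp(−‖a−h‖²/(2σ²)) da‖ ≤ (M/σ) · √2 · Γ((p+1)/2) / Γ(p/2). (With M = B_r/(1−γ) and σ = 1 this gives the bound ‖D(s)‖ ≤ B_D of the paper.) -/
open MeasureTheory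

/-- The radial integrand `r ^ (p - 1) * (r * exp (-b r²))` written with a real exponent. -/
lemma pow_sub_one_smul_mul_exp_neg_mul_sq (b : ℝ) {p : ℕ} (hp : 1 ≤ p) (r : ℝ) :
    r ^ (p - 1) • (r * Real.exp (-b * r ^ 2)) =
      r ^ (p : ℝ) * Real.exp (-b * r ^ (2 : ℝ)) := by
  rw [smul_eq_mul, ← mul_assoc, pow_sub_one_mul (by omega), Real.rpow_natCast, Real.rpow_two]

lemma integrable_norm_mul_exp_neg_mul_norm_sq {p : ℕ} (hp : 1 ≤ p) {b : ℝ} (hb : 0 < b) :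
    Integrable fun x : EuclideanSpace ℝ (Fin p) ↦ ‖x‖ * Real.exp (-b * ‖x‖ ^ 2) := by
  have : Nonempty (Fin p) := ⟨⟨0, hp⟩⟩
  rw [integrable_fun_norm_addHaar volume (f := fun r ↦ r * Real.exp (-b * r ^ 2))]
  simp only [finrank_euclideanSpace, Fintype.card_fin, pow_sub_one_smul_mul_exp_neg_mul_sq b hp]
  exact integrableOn_rpow_mul_exp_neg_mul_rpow (by linarith [p.cast_nonneg (α := ℝ)]) two_pos hb

lemma integral_norm_mul_exp_neg_mul_norm_sq {p : ℕ} (hp : 1 ≤ p) {b : ℝ} (hb : 0 < b) :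
    ∫ x : EuclideanSpace ℝ (Fin p), ‖x‖ * Real.exp (-b * ‖x‖ ^ 2) =
      √Real.pi ^ p * b ^ (-((p : ℝ) + 1) / 2) *
        (Real.Gamma (((p : ℝ) + 1) / 2) / Real.Gamma ((p : ℝ) / 2)) := by
  have : Nonempty (Fin p) := ⟨⟨0, hp⟩⟩
  have hp0 : (0 : ℝ) < p := by exact_mod_cast hp
  have hG : 0 < Real.Gamma ((p : ℝ) / 2) := Real.Gamma_pos_of_pos (by positivity)
  rw [integral_fun_norm_addHaar volume (fun r ↦ r * Real.exp (-b * r ^ 2))]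
  simp only [finrank_euclideanSpace, Fintype.card_fin, pow_sub_one_smul_mul_exp_neg_mul_sq b hp]
  rw [integral_rpow_mul_exp_neg_mul_rpow two_pos (by linarith) hb, Measure.real,
    EuclideanSpace.volume_ball, Fintype.card_fin, ENNReal.ofReal_one, one_pow, one_mul,
    Real.Gamma_add_one (by positivity), ENNReal.toReal_ofReal (by positivity)]
  simp only [nsmul_eq_mul, smul_eq_mul]
  field_simp

/-- The normalising constant of the Gaussian density against the powers produced by polar
coordinates. -/
lemma gaussian_normalization_mul_rpow (p : ℕ) {σ : ℝ} (hσ : 0 < σ) :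
    (2 * Real.pi * σ ^ 2) ^ (-(p : ℝ) / 2) *
        (√Real.pi ^ p * ((2 * σ ^ 2)⁻¹) ^ (-((p : ℝ) + 1) / 2)) = √2 * σ := by
  have hpi := Real.pi_pos
  have hs : 0 < 2 * σ ^ 2 := by positivity
  have h₁ : √Real.pi ^ p = Real.pi ^ ((p : ℝ) / 2) := by
    rw [Real.sqrt_eq_rpow, ← Real.rpow_natCast, ← Real.rpow_mul hpi.le]
    ring_nf
  rw [h₁, Real.inv_rpow hs.le, ← Real.rpow_neg hs.le,
    show 2 * Real.pi * σ ^ 2 = Real.pi * (2 * σ ^ 2) by ring, Real.mul_rpow hpi.le hs.le,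
    mul_mul_mul_comm, ← Real.rpow_add hpi, ← Real.rpow_add hs,
    show -(p : ℝ) / 2 + p / 2 = 0 by ring,
    show -(p : ℝ) / 2 + -(-((p : ℝ) + 1) / 2) = 1 / 2 by ring, Real.rpow_zero, one_mul,
    ← Real.sqrt_eq_rpow, Real.sqrt_mul zero_le_two, Real.sqrt_sq hσ.le]

/-- Bound on the Gaussian-smoothed score integral: if `|Q| ≤ M`, then
`‖∫ Q(a) σ⁻²(a−h) g(a;h,σ²I) da‖ ≤ (M/σ) √2 Γ((p+1)/2)/Γ(p/2)`, where `g(·;h,σ²I)` is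
the Gaussian density with mean `h` and covariance `σ²I`. -/
theorem norm_gaussian_score_integral_le
    (p : ℕ) (hp : 1 ≤ p) (σ M : ℝ) (hσ : 0 < σ) (hM : 0 ≤ M)
    (h : EuclideanSpace ℝ (Fin p)) (Q : EuclideanSpace ℝ (Fin p) → ℝ)
    (hQmeas : Measurable Q) (hQbd : ∀ a, |Q a| ≤ M) :
    ‖∫ a : EuclideanSpace ℝ (Fin p),
        (Q a * (σ ^ 2)⁻¹ *
          ((2 * Real.pi * σ ^ 2) ^ (-(p : ℝ) / 2) *
            Real.exp (-‖a - h‖ ^ 2 / (2 * σ ^ 2)))) • (a - h)‖ ≤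
      M / σ * (Real.sqrt 2 * Real.Gamma (((p : ℝ) + 1) / 2) / Real.Gamma ((p : ℝ) / 2)) := by
  have hb : 0 < (2 * σ ^ 2)⁻¹ := by positivity
  have hpi := Real.pi_pos
  have hint := ((integrable_norm_mul_exp_neg_mul_norm_sq hp hb).comp_sub_right h).const_mul
    (M * (σ ^ 2)⁻¹ * (2 * Real.pi * σ ^ 2) ^ (-(p : ℝ) / 2))
  refine (norm_integral_le_of_norm_le hint (.of_forall fun a ↦ ?_)).trans_eq ?_
  · have hexp : -‖a - h‖ ^ 2 / (2 * σ ^ 2) = -(2 * σ ^ 2)⁻¹ * ‖a - h‖ ^ 2 := by ring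
    rw [norm_smul, norm_mul, norm_mul, Real.norm_eq_abs (Q a), hexp,
      Real.norm_of_nonneg (by positivity : 0 ≤ (σ ^ 2)⁻¹), Real.norm_of_nonneg (by positivity)]
    calc _ ≤ M * (σ ^ 2)⁻¹ * ((2 * Real.pi * σ ^ 2) ^ (-(p : ℝ) / 2) *
          Real.exp (-(2 * σ ^ 2)⁻¹ * ‖a - h‖ ^ 2)) * ‖a - h‖ := by gcongr; exact hQbd a
      _ = _ := by ring
  · rw [integral_const_mul,
      integral_sub_right_eq_self (fun x ↦ ‖x‖ * Real.exp (-(2 * σ ^ 2)⁻¹ * ‖x‖ ^ 2)) h,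
      integral_norm_mul_exp_neg_mul_norm_sq hp hb]
    calc _ = M * (σ ^ 2)⁻¹ * ((2 * Real.pi * σ ^ 2) ^ (-(p : ℝ) / 2) *
          (√Real.pi ^ p * ((2 * σ ^ 2)⁻¹) ^ (-((p : ℝ) + 1) / 2))) *
          (Real.Gamma (((p : ℝ) + 1) / 2) / Real.Gamma ((p : ℝ) / 2)) := by ring
      _ = _ := by
        rw [gaussian_normalization_mul_rpow p hσ]
        field_simp
end

section
/- Let p ≥ 1, σ > 0, and let f : ℝᵖ → ℝ be differentiable and Lipschitz. Then ∫_{ℝᵖ} f(z) z (2πσ²)^{−p/2} exp(−‖z‖²/(2σ²)) dz = σ² ∫_{ℝᵖ} ∇f(z) (2πσ²)^{−p/2} exp(−‖z‖²/(2σ²)) dz (multivariate Gaussian integration by parts / Stein's identity). -/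
open MeasureTheory

theorem fderiv_exp_neg_mul_sq_norm_apply {E : Type*} [NormedAddCommGroup E]
    [InnerProductSpace ℝ E] (b : ℝ) (z v : E) :
    fderiv ℝ (fun z : E => Real.exp (-b * ‖z‖ ^ 2)) z v =
      -(2 * b) * (Real.exp (-b * ‖z‖ ^ 2) * inner ℝ z v) := by
  have := (((hasStrictFDerivAt_norm_sq z).hasFDerivAt.const_mul (-b)).exp).fderiv
  rw [this]
  simp
  ring

section GaussianWeight

variable {E F : Type*} [NormedAddCommGroup E] [InnerProductSpace ℝ E] [FiniteDimensional ℝ E]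
  [MeasurableSpace E] [BorelSpace E] [NormedAddCommGroup F] [NormedSpace ℝ F]

theorem integrable_exp_neg_mul_sq_norm {b : ℝ} (hb : 0 < b) :
    Integrable fun z : E => Real.exp (-b * ‖z‖ ^ 2) := by
  by_contra h
  have hint := GaussianFourier.integral_rexp_neg_mul_sq_norm (V := E) hb
  rw [integral_undef h] at hint
  have : 0 < (Real.pi / b) ^ ((Module.finrank ℝ E : ℝ) / 2) := by positivity
  exact this.ne hint

/-- A function of at most quadratic growth is integrable against a Gaussian weight. -/
theorem integrable_exp_neg_mul_sq_norm_smul {b : ℝ} (hb : 0 < b) {h : E → F}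
    (hm : AEStronglyMeasurable h) {A B : ℝ} (hB : 0 ≤ B) (hh : ∀ z, ‖h z‖ ≤ A + B * ‖z‖ ^ 2) :
    Integrable fun z : E => Real.exp (-b * ‖z‖ ^ 2) • h z := by
  have hmaj : Integrable fun z : E => A * Real.exp (-b * ‖z‖ ^ 2) +
      B * (2 / b) * Real.exp (-(b / 2) * ‖z‖ ^ 2) :=
    ((integrable_exp_neg_mul_sq_norm hb).const_mul A).add
      ((integrable_exp_neg_mul_sq_norm (half_pos hb)).const_mul _)
  refine hmaj.mono' (AEStronglyMeasurable.smul
    (by fun_prop : Continuous fun z : E => Real.exp (-b * ‖z‖ ^ 2)).aestronglyMeasurable hm)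
    (ae_of_all _ fun z => ?_)
  have hsq : ‖z‖ ^ 2 * Real.exp (-b * ‖z‖ ^ 2) ≤ 2 / b * Real.exp (-(b / 2) * ‖z‖ ^ 2) := by
    have hexp : b / 2 * ‖z‖ ^ 2 ≤ Real.exp (b / 2 * ‖z‖ ^ 2) := by
      linarith [Real.add_one_le_exp (b / 2 * ‖z‖ ^ 2)]
    calc ‖z‖ ^ 2 * Real.exp (-b * ‖z‖ ^ 2)
        = 2 / b * ((b / 2 * ‖z‖ ^ 2) * Real.exp (-b * ‖z‖ ^ 2)) := by field_simp
      _ ≤ 2 / b * (Real.exp (b / 2 * ‖z‖ ^ 2) * Real.exp (-b * ‖z‖ ^ 2)) := by gcongr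
      _ = 2 / b * Real.exp (-(b / 2) * ‖z‖ ^ 2) := by
        rw [← Real.exp_add]
        ring_nf
  rw [norm_smul, Real.norm_of_nonneg (Real.exp_pos _).le]
  calc Real.exp (-b * ‖z‖ ^ 2) * ‖h z‖
      ≤ Real.exp (-b * ‖z‖ ^ 2) * (A + B * ‖z‖ ^ 2) := by gcongr; exact hh z
    _ = A * Real.exp (-b * ‖z‖ ^ 2) + B * (‖z‖ ^ 2 * Real.exp (-b * ‖z‖ ^ 2)) := by ring
    _ ≤ A * Real.exp (-b * ‖z‖ ^ 2) + B * (2 / b * Real.exp (-(b / 2) * ‖z‖ ^ 2)) := by gcongr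
    _ = _ := by ring

/-- **Gaussian integration by parts**, with an unnormalized Gaussian weight. -/
theorem integral_exp_neg_mul_sq_norm_smul_gradient {b : ℝ} (hb : 0 < b) {f : E → ℝ}
    (hf : Differentiable ℝ f) {K : NNReal} (hlip : LipschitzWith K f) :
    ∫ z : E, Real.exp (-b * ‖z‖ ^ 2) • gradient f z =
      (2 * b) • ∫ z : E, Real.exp (-b * ‖z‖ ^ 2) • f z • z := by
  have hfb (z : E) : ‖f z‖ ≤ ‖f 0‖ + K * ‖z‖ := by
    have h1 := hlip.norm_sub_le z 0
    have h2 := norm_le_norm_add_norm_sub' (f z) (f 0)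
    rw [sub_zero] at h1
    linarith
  have hK : (0 : ℝ) ≤ K := K.2
  have hgrad : Integrable fun z : E => Real.exp (-b * ‖z‖ ^ 2) • gradient f z := by
    refine integrable_exp_neg_mul_sq_norm_smul hb (A := K) (B := 0) ?_ le_rfl fun z => ?_
    · exact ((InnerProductSpace.toDual ℝ E).symm.continuous.measurable.comp
        (measurable_fderiv ℝ f)).aestronglyMeasurable
    · rw [gradient, LinearIsometryEquiv.norm_map]
      simpa using norm_fderiv_le_of_lipschitz ℝ hlip
  have hfz : Integrable fun z : E => Real.exp (-b * ‖z‖ ^ 2) • f z • z := by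
    refine integrable_exp_neg_mul_sq_norm_smul hb (A := ‖f 0‖) (B := ‖f 0‖ + K)
      (hf.continuous.smul continuous_id).aestronglyMeasurable (by positivity) fun z => ?_
    rw [norm_smul]
    have := mul_le_mul_of_nonneg_right (hfb z) (norm_nonneg z)
    nlinarith [mul_nonneg (norm_nonneg (f 0)) (sq_nonneg (‖z‖ - 1)),
      mul_nonneg (norm_nonneg (f 0)) (norm_nonneg z), norm_nonneg (f 0)]
  have hfint : Integrable fun z : E => Real.exp (-b * ‖z‖ ^ 2) • f z := by
    refine integrable_exp_neg_mul_sq_norm_smul hb (A := ‖f 0‖ + K) (B := K)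
      hf.continuous.aestronglyMeasurable hK fun z => (hfb z).trans ?_
    nlinarith [mul_nonneg hK (sq_nonneg (‖z‖ - 1)), mul_nonneg hK (sq_nonneg ‖z‖)]
  refine ext_inner_left ℝ fun v => ?_
  rw [inner_smul_right, ← integral_inner hgrad, ← integral_inner hfz]
  have hgv (z : E) : inner ℝ v (Real.exp (-b * ‖z‖ ^ 2) • gradient f z) =
      fderiv ℝ f z v * Real.exp (-b * ‖z‖ ^ 2) := by
    rw [inner_smul_right, real_inner_comm, gradient, InnerProductSpace.toDual_symm_apply, mul_comm]
  have hfv (z : E) : f z * fderiv ℝ (fun z : E => Real.exp (-b * ‖z‖ ^ 2)) z v =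
      -(2 * b) * inner ℝ v (Real.exp (-b * ‖z‖ ^ 2) • f z • z) := by
    rw [fderiv_exp_neg_mul_sq_norm_apply, inner_smul_right, inner_smul_right, real_inner_comm]
    ring
  have hparts := integral_mul_fderiv_eq_neg_fderiv_mul_of_integrable
    (μ := (volume : Measure E)) (f := f) (g := fun z : E => Real.exp (-b * ‖z‖ ^ 2)) (v := v)
    (by simpa only [hgv] using hgrad.const_inner (𝕜 := ℝ) v)
    (by simpa only [hfv] using (hfz.const_inner (𝕜 := ℝ) v).const_mul (-(2 * b)))
    (by simpa only [smul_eq_mul, mul_comm] using hfint)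
    (fun z _ => hf z)
    (fun z _ => (((hasStrictFDerivAt_norm_sq z).hasFDerivAt.const_mul (-b)).exp).differentiableAt)
  simp only [hfv, integral_const_mul] at hparts
  simp only [hgv]
  linarith

end GaussianWeight

/-- **Stein's identity / Gaussian integration by parts.** For a
differentiable Lipschitz `f : ℝᵖ → ℝ` and the centered Gaussian density with
covariance `σ²I`:
`∫ f(z) z g(z) dz = σ² ∫ ∇f(z) g(z) dz`. -/
theorem gaussian_integration_by_parts
    (p : ℕ) (hp : 1 ≤ p) (σ : ℝ) (hσ : 0 < σ)
    (f : EuclideanSpace ℝ (Fin p) → ℝ) (hf : Differentiable ℝ f)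
    (K : NNReal) (hlip : LipschitzWith K f) :
    (∫ z : EuclideanSpace ℝ (Fin p),
        (f z * ((2 * Real.pi * σ ^ 2) ^ (-(p : ℝ) / 2) *
          Real.exp (-‖z‖ ^ 2 / (2 * σ ^ 2)))) • z) =
      σ ^ 2 • ∫ z : EuclideanSpace ℝ (Fin p),
        ((2 * Real.pi * σ ^ 2) ^ (-(p : ℝ) / 2) *
          Real.exp (-‖z‖ ^ 2 / (2 * σ ^ 2))) • gradient f z := by
  have hmain := integral_exp_neg_mul_sq_norm_smul_gradient
    (b := (2 * σ ^ 2)⁻¹) (by positivity) hf hlip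
  have hexp (z : EuclideanSpace ℝ (Fin p)) :
      -‖z‖ ^ 2 / (2 * σ ^ 2) = -(2 * σ ^ 2)⁻¹ * ‖z‖ ^ 2 := by
    rw [div_eq_inv_mul, mul_neg, neg_mul]
  have hfz (z : EuclideanSpace ℝ (Fin p)) (c e : ℝ) : (f z * (c * e)) • z = c • e • f z • z := by
    simp only [smul_smul]
    ring_nf
  simp only [hexp, hfz]
  simp only [mul_smul, integral_smul]
  rw [hmain, smul_comm (σ ^ 2), smul_smul (σ ^ 2)]
  have hone : σ ^ 2 * (2 * (2 * σ ^ 2)⁻¹) = 1 := by field_simp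
  rw [hone, one_smul]
end

section
/- Let p ≥ 1, σ > 0, h ∈ ℝᵖ, and let Q : ℝᵖ → ℝ be differentiable with ∇Q Lipschitz with constant L_g. Then ‖σ^{−2} ∫_{ℝᵖ} Q(h+u) u (2πσ²)^{−p/2} exp(−‖u‖²/(2σ²)) du − ∇Q(h)‖ ≤ L_g · σ · √2 · Γ((p+1)/2)/Γ(p/2). (The Gaussian-smoothed score estimate D approximates the derivative of the Q-function with an error linear in the standard deviation of the policy.) -/
open MeasureTheory

section GaussianWeight

variable {E : Type*} [NormedAddCommGroup E] [InnerProductSpace ℝ E] [FiniteDimensional ℝ E]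

theorem norm_le_of_norm_gradient_le {f : E → ℝ} (hf : Differentiable ℝ f) {A : ℝ}
    (hA : ∀ u, ‖gradient f u‖ ≤ A * (1 + ‖u‖)) (u : E) :
    ‖f u‖ ≤ (‖f 0‖ + A) * (1 + ‖u‖) ^ 2 := by
  have hA0 : 0 ≤ A := by simpa using (norm_nonneg _).trans (hA 0)
  have hmv : ‖f u - f 0‖ ≤ A * (1 + ‖u‖) * ‖u - 0‖ := by
    refine (convex_closedBall (0 : E) ‖u‖).norm_image_sub_le_of_norm_fderiv_le (𝕜 := ℝ)
      (fun x _ => hf x) (fun x hx => ?_) (by simp) (by simp)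
    rw [← toDual_gradient, LinearIsometryEquiv.norm_map]
    refine (hA x).trans ?_
    gcongr
    simpa using hx
  have h1 : ‖f u‖ ≤ ‖f 0‖ + ‖f u - f 0‖ := by
    simpa using norm_add_le (f 0) (f u - f 0)
  rw [sub_zero] at hmv
  have h2 := norm_nonneg u
  have h3 := norm_nonneg (f 0)
  nlinarith [mul_nonneg hA0 h2, mul_nonneg h3 h2, mul_nonneg h3 (mul_nonneg h2 h2)]

variable [MeasurableSpace E] [BorelSpace E]

open Module in
theorem integral_norm_pow_mul_exp_neg_mul_sq [Nontrivial E] {b : ℝ} (hb : 0 < b) (k : ℕ) :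
    ∫ u : E, ‖u‖ ^ k * Real.exp (-b * ‖u‖ ^ 2) =
      finrank ℝ E * volume.real (Metric.ball (0 : E) 1) *
        (b ^ (-((finrank ℝ E : ℝ) + k) / 2) * (1 / 2) *
          Real.Gamma (((finrank ℝ E : ℝ) + k) / 2)) := by
  have hd : 1 ≤ finrank ℝ E := finrank_pos
  rw [integral_fun_norm_addHaar volume (fun r : ℝ => r ^ k * Real.exp (-b * r ^ 2))]
  have hq : ((finrank ℝ E - 1 + k : ℕ) : ℝ) + 1 = finrank ℝ E + k := by
    push_cast [hd]; ring
  have key := integral_rpow_mul_exp_neg_mul_rpow (p := 2) (q := ((finrank ℝ E - 1 + k : ℕ) : ℝ))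
    two_pos (neg_one_lt_zero.trans_le (Nat.cast_nonneg _)) hb
  rw [hq] at key
  rw [← key, nsmul_eq_mul, smul_eq_mul, mul_assoc]
  congr 2
  refine integral_congr_ae (.of_forall fun y => ?_)
  simp only [smul_eq_mul, Real.rpow_natCast, Real.rpow_two, pow_add, mul_assoc]

theorem integrable_norm_pow_mul_exp_neg_mul_sq {b : ℝ} (hb : 0 < b) (k : ℕ) :
    Integrable fun u : E => ‖u‖ ^ k * Real.exp (-b * ‖u‖ ^ 2) := by
  cases subsingleton_or_nontrivial E
  · exact (integrable_const (‖(0 : E)‖ ^ k * Real.exp (-b * ‖(0 : E)‖ ^ 2))).congr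
      (.of_forall fun u => by simp [Subsingleton.elim u 0])
  rw [integrable_fun_norm_addHaar volume (f := fun r : ℝ => r ^ k * Real.exp (-b * r ^ 2))]
  refine (integrableOn_rpow_mul_exp_neg_mul_sq hb
    (s := ((Module.finrank ℝ E - 1 + k : ℕ) : ℝ))
    (neg_one_lt_zero.trans_le (Nat.cast_nonneg _))).congr_fun (fun y _ => ?_) measurableSet_Ioi
  simp only [smul_eq_mul, Real.rpow_natCast, pow_add, mul_assoc]

/-- Functions of polynomial growth are integrable against a Gaussian weight. -/
theorem integrable_exp_neg_mul_sq_smul {G : Type*} [NormedAddCommGroup G] [NormedSpace ℝ G]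
    {b : ℝ} (hb : 0 < b) {g : E → G} (hg : Continuous g) {C : ℝ} {k : ℕ}
    (hbound : ∀ u, ‖g u‖ ≤ C * (1 + ‖u‖) ^ k) :
    Integrable fun u : E => Real.exp (-b * ‖u‖ ^ 2) • g u := by
  have hC : 0 ≤ C := by simpa using (norm_nonneg _).trans (hbound 0)
  have hint : Integrable fun u : E =>
      C * (2 ^ (k - 1) * (‖u‖ ^ 0 * Real.exp (-b * ‖u‖ ^ 2) +
        ‖u‖ ^ k * Real.exp (-b * ‖u‖ ^ 2))) :=
    (((integrable_norm_pow_mul_exp_neg_mul_sq hb 0).add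
      (integrable_norm_pow_mul_exp_neg_mul_sq hb k)).const_mul _).const_mul _
  refine hint.mono' (Continuous.aestronglyMeasurable (by fun_prop)) (.of_forall fun u => ?_)
  rw [norm_smul, Real.norm_of_nonneg (Real.exp_pos _).le]
  calc Real.exp (-b * ‖u‖ ^ 2) * ‖g u‖
      ≤ Real.exp (-b * ‖u‖ ^ 2) * (C * (2 ^ (k - 1) * (1 ^ k + ‖u‖ ^ k))) := by
        gcongr
        refine (hbound u).trans ?_
        gcongr
        exact add_pow_le zero_le_one (norm_nonneg u) k
    _ = _ := by ring

/-- Gaussian integration by parts. -/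
theorem integral_exp_neg_mul_sq_smul_gradient {b : ℝ} (hb : 0 < b) {f : E → ℝ}
    (hf : Differentiable ℝ f) (hf' : Continuous (gradient f)) {A : ℝ}
    (hA : ∀ u, ‖gradient f u‖ ≤ A * (1 + ‖u‖)) :
    ∫ u, Real.exp (-b * ‖u‖ ^ 2) • gradient f u =
      (2 * b) • ∫ u, Real.exp (-b * ‖u‖ ^ 2) • f u • u := by
  have hA0 : 0 ≤ A := by simpa using (norm_nonneg _).trans (hA 0)
  have hfu := norm_le_of_norm_gradient_le hf hA
  have hfc := hf.continuous
  have hgrad : Integrable fun u => Real.exp (-b * ‖u‖ ^ 2) • gradient f u :=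
    integrable_exp_neg_mul_sq_smul hb hf' (k := 1) (by simpa using hA)
  have hval : Integrable fun u => Real.exp (-b * ‖u‖ ^ 2) • f u :=
    integrable_exp_neg_mul_sq_smul hb hfc hfu
  have hmom : Integrable fun u => Real.exp (-b * ‖u‖ ^ 2) • f u • u := by
    refine integrable_exp_neg_mul_sq_smul hb (k := 3) (C := ‖f 0‖ + A) (by fun_prop) fun u => ?_
    rw [norm_smul, pow_succ, ← mul_assoc]
    gcongr
    · exact hfu u
    · linarith
  have hder (u v : E) : fderiv ℝ (fun u : E => Real.exp (-b * ‖u‖ ^ 2)) u v =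
      -(2 * b) * (Real.exp (-b * ‖u‖ ^ 2) * inner ℝ v u) := by
    have := (((hasStrictFDerivAt_norm_sq u).hasFDerivAt).const_mul (-b)).exp
    rw [this.fderiv]
    simp [real_inner_comm]
    ring
  refine ext_inner_left ℝ fun v => ?_
  rw [inner_smul_right, ← integral_inner hgrad, ← integral_inner hmom]
  have hparts := integral_mul_fderiv_eq_neg_fderiv_mul_of_integrable (μ := (volume : Measure E))
    (f := f) (g := fun u : E => Real.exp (-b * ‖u‖ ^ 2)) (v := v) ?_ ?_ ?_
    (fun x _ => hf x)
    (fun x _ => (((hasStrictFDerivAt_norm_sq x).hasFDerivAt).const_mul (-b)).exp.differentiableAt)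
  · simp only [hder, ← inner_gradient_left] at hparts
    rw [← neg_inj, ← integral_const_mul, ← integral_neg]
    rw [← integral_neg] at hparts ⊢
    refine Eq.trans ?_ (hparts.symm.trans ?_)
    all_goals
      refine integral_congr_ae (.of_forall fun u => ?_)
      simp only [inner_smul_right, real_inner_comm]
      ring
  · refine (hgrad.const_inner v).congr (.of_forall fun u => ?_)
    simp only [inner_smul_right, ← inner_gradient_left, real_inner_comm v]
    ring
  · refine ((hmom.const_inner v).const_mul (-(2 * b))).congr (.of_forall fun u => ?_)
    simp only [inner_smul_right, hder]
    ring
  · exact hval.congr (.of_forall fun u => by simp [mul_comm])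

theorem integral_norm_mul_exp_neg_mul_sq [Nontrivial E] {b : ℝ} (hb : 0 < b) :
    ∫ u : E, ‖u‖ * Real.exp (-b * ‖u‖ ^ 2) =
      b ^ (-(1 / 2) : ℝ) * (Real.Gamma (((Module.finrank ℝ E : ℝ) + 1) / 2) /
        Real.Gamma ((Module.finrank ℝ E : ℝ) / 2)) * ∫ u : E, Real.exp (-b * ‖u‖ ^ 2) := by
  have h0 := integral_norm_pow_mul_exp_neg_mul_sq (E := E) hb 0
  have h1 := integral_norm_pow_mul_exp_neg_mul_sq (E := E) hb 1
  simp only [pow_zero, one_mul, Nat.cast_zero, add_zero, pow_one, Nat.cast_one] at h0 h1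
  have hd : (0 : ℝ) < Module.finrank ℝ E := Nat.cast_pos.mpr Module.finrank_pos
  have hG := (Real.Gamma_pos_of_pos (half_pos hd)).ne'
  rw [h0, h1, show (-((Module.finrank ℝ E : ℝ) + 1) / 2) =
    -(1 / 2) + -(Module.finrank ℝ E : ℝ) / 2 by ring, Real.rpow_add hb]
  field_simp

/-- Smoothing a function with `L`-Lipschitz gradient by the (unnormalized) weight
`exp (-b * ‖u‖ ^ 2)` moves its gradient by at most `L` times the first moment of the weight. -/
theorem norm_integral_exp_neg_mul_sq_smul_sub_gradient_le {b : ℝ} (hb : 0 < b) {f : E → ℝ}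
    (hf : Differentiable ℝ f) {K : NNReal} (hK : LipschitzWith K (gradient f)) :
    ‖((2 * b) • ∫ u, Real.exp (-b * ‖u‖ ^ 2) • f u • u) -
        (∫ u : E, Real.exp (-b * ‖u‖ ^ 2)) • gradient f 0‖ ≤
      K * ∫ u : E, ‖u‖ * Real.exp (-b * ‖u‖ ^ 2) := by
  have hlip (u : E) : ‖gradient f u - gradient f 0‖ ≤ K * ‖u‖ := by
    simpa using hK.norm_sub_le u 0
  have hA (u : E) : ‖gradient f u‖ ≤ (‖gradient f 0‖ + K) * (1 + ‖u‖) := by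
    have h1 : ‖gradient f u‖ ≤ ‖gradient f 0‖ + ‖gradient f u - gradient f 0‖ := by
      simpa using norm_add_le (gradient f 0) (gradient f u - gradient f 0)
    nlinarith [hlip u, mul_nonneg (norm_nonneg (gradient f 0)) (norm_nonneg u), K.coe_nonneg]
  have hgrad : Integrable fun u => Real.exp (-b * ‖u‖ ^ 2) • gradient f u :=
    integrable_exp_neg_mul_sq_smul hb hK.continuous (k := 1) (by simpa using hA)
  have hconst : Integrable fun u : E => Real.exp (-b * ‖u‖ ^ 2) • gradient f 0 :=
    integrable_exp_neg_mul_sq_smul hb continuous_const (k := 0) (C := ‖gradient f 0‖) (by simp)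
  rw [← integral_exp_neg_mul_sq_smul_gradient hb hf hK.continuous hA, ← integral_smul_const,
    ← integral_sub hgrad hconst, ← integral_const_mul]
  refine norm_integral_le_of_norm_le ?_ (.of_forall fun u => ?_)
  · simpa using (integrable_norm_pow_mul_exp_neg_mul_sq (E := E) hb 1).const_mul (K : ℝ)
  · rw [← smul_sub, norm_smul, Real.norm_of_nonneg (Real.exp_pos _).le]
    calc _ ≤ Real.exp (-b * ‖u‖ ^ 2) * (K * ‖u‖) := by gcongr; exact hlip u
      _ = _ := by ring

end GaussianWeight

/-- The Gaussian-smoothed score estimate approximates the gradient of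
`Q` with error linear in `σ`: if `∇Q` is `L_g`-Lipschitz, then
`‖σ⁻² ∫ Q(h+u) u g(u) du − ∇Q(h)‖ ≤ L_g σ √2 Γ((p+1)/2)/Γ(p/2)`, where `g` is the
centered Gaussian density with covariance `σ²I`. -/
theorem gaussian_smoothing_gradient_error
    (p : ℕ) (hp : 1 ≤ p) (σ : ℝ) (hσ : 0 < σ)
    (h : EuclideanSpace ℝ (Fin p))
    (Q : EuclideanSpace ℝ (Fin p) → ℝ) (hQ : Differentiable ℝ Q)
    (Lg : ℝ) (hLg : 0 ≤ Lg)
    (hgradLip : LipschitzWith Lg.toNNReal (gradient Q)) :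
    ‖(σ ^ 2)⁻¹ •
          (∫ u : EuclideanSpace ℝ (Fin p),
            (Q (h + u) * ((2 * Real.pi * σ ^ 2) ^ (-(p : ℝ) / 2) *
              Real.exp (-‖u‖ ^ 2 / (2 * σ ^ 2)))) • u) -
        gradient Q h‖ ≤
      Lg * σ * (Real.sqrt 2 * Real.Gamma (((p : ℝ) + 1) / 2) / Real.Gamma ((p : ℝ) / 2)) := by
  have : NeZero p := ⟨by omega⟩
  set b : ℝ := (2 * σ ^ 2)⁻¹ with hbdef
  have hb : 0 < b := by positivity
  set c : ℝ := (2 * Real.pi * σ ^ 2) ^ (-(p : ℝ) / 2) with hc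
  have hc0 : 0 ≤ c := by positivity
  have hmass : c * ∫ u : EuclideanSpace ℝ (Fin p), Real.exp (-b * ‖u‖ ^ 2) = 1 := by
    rw [GaussianFourier.integral_rexp_neg_mul_sq_norm hb, hc, finrank_euclideanSpace_fin,
      show Real.pi / b = 2 * Real.pi * σ ^ 2 by rw [hbdef]; field_simp,
      ← Real.rpow_add (by positivity), show -(p : ℝ) / 2 + p / 2 = 0 by ring, Real.rpow_zero]
  have hroot : b ^ (-(1 / 2) : ℝ) = σ * √2 := by
    rw [Real.rpow_neg hb.le, ← Real.sqrt_eq_rpow, hbdef, Real.sqrt_inv, inv_inv,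
      Real.sqrt_mul zero_le_two, Real.sqrt_sq hσ.le, mul_comm]
  have hfgrad (u : EuclideanSpace ℝ (Fin p)) :
      gradient (fun u => Q (h + u)) u = gradient Q (h + u) := by
    simp only [gradient, fderiv_comp_add_left]
  have hlip : LipschitzWith Lg.toNNReal (gradient fun u => Q (h + u)) := by
    rw [funext hfgrad]
    refine LipschitzWith.of_dist_le_mul fun x y => ?_
    simpa using hgradLip.dist_le_mul (h + x) (h + y)
  have hmain := norm_integral_exp_neg_mul_sq_smul_sub_gradient_le hb
    (f := fun u => Q (h + u)) (hQ.comp (by fun_prop)) hlip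
  rw [integral_norm_mul_exp_neg_mul_sq hb, hfgrad, add_zero, Real.coe_toNNReal Lg hLg,
    finrank_euclideanSpace_fin, hroot] at hmain
  have hint : (∫ u : EuclideanSpace ℝ (Fin p),
      (Q (h + u) * (c * Real.exp (-‖u‖ ^ 2 / (2 * σ ^ 2)))) • u) =
      c • ∫ u : EuclideanSpace ℝ (Fin p), Real.exp (-b * ‖u‖ ^ 2) • Q (h + u) • u := by
    rw [← integral_smul]
    refine integral_congr_ae (.of_forall fun u => ?_)
    have hexp : -‖u‖ ^ 2 / (2 * σ ^ 2) = -b * ‖u‖ ^ 2 := by rw [hbdef]; ring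
    simp only [smul_smul, hexp]
    congr 1
    ring
  have hsq : (σ ^ 2)⁻¹ = 2 * b := by rw [hbdef]; field_simp
  have hgrad : gradient Q h =
      c • (∫ u : EuclideanSpace ℝ (Fin p), Real.exp (-b * ‖u‖ ^ 2)) • gradient Q h := by
    rw [smul_smul, hmass, one_smul]
  rw [hint, hsq, smul_comm (2 * b) c, hgrad, ← smul_sub, norm_smul, Real.norm_of_nonneg hc0]
  refine (mul_le_mul_of_nonneg_left hmain hc0).trans_eq ?_
  linear_combination Lg * (σ * √2 * (Real.Gamma (((p : ℝ) + 1) / 2) / Real.Gamma ((p : ℝ) / 2))) *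
    hmass
end
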